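/- In the minimum-counterexample setup, let c be an acyclic edge coloring of G−xy using Δ+1 colors, and suppose u is a neighbor of x of degree at least 3 with c(x,u) = c(y,y') = μ. For γ ∈ C − F''_x(c), define c_γ = c if γ ∉ F_x(c), and otherwise let c_γ be obtained from c by uncoloring the edge xw where w is the degree-2 neighbor of x with c(x,w)=γ. Then every (μ,γ,xy)-critical path with respect to c_γ has length at least five. -/

import Mathlib

open SimpleGraph

namespace AEC

variable {V : Type*}

/-- The set of colors appearing (under partial coloring `c`) on colored edges incident
with the vertex `u` (i.e. `F_u`). -/
def colorsAt (G : SimpleGraph V) (c : Sym2 V → Option ℕ) (u : V) : Set ℕ :=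
  {γ | ∃ z, G.Adj u z ∧ c s(u, z) = some γ}

/-- `S_ab`: the set of colors appearing on the colored edges incident with `b`
other than the edge `ab`. -/
def Sset (G : SimpleGraph V) (c : Sym2 V → Option ℕ) (a b : V) : Set ℕ :=
  {γ | ∃ z, G.Adj b z ∧ z ≠ a ∧ c s(b, z) = some γ}

/-- A partial edge coloring (colors are `ℕ`, `none` = uncolored): it may only color
edges of `G`, and colored edges sharing an endpoint receive distinct colors. -/
def ProperPartialColoring (G : SimpleGraph V) (c : Sym2 V → Option ℕ) : Prop :=
  (∀ e, (c e).isSome → e ∈ G.edgeSet) ∧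
  ∀ ⦃u v w : V⦄, G.Adj u v → G.Adj u w → v ≠ w → (c s(u, v)).isSome →
    c s(u, v) ≠ c s(u, w)

/-- A valid (acyclic) partial coloring: proper, and no cycle of `G` is bichromatic,
i.e. no cycle has all of its edges colored using only two colors. -/
def AcyclicPartialColoring (G : SimpleGraph V) (c : Sym2 V → Option ℕ) : Prop :=
  ProperPartialColoring G c ∧
  ∀ (α β : ℕ) (v : V) (W : G.Walk v v), W.IsCycle →
    ¬ ∀ e ∈ W.edges, c e = some α ∨ c e = some β

/-- An acyclic edge coloring of `G` using (at most) `k` colors: a valid partial coloring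
that colors every edge of `G` with a color `< k`. -/
def IsAcyclicEdgeColoring (G : SimpleGraph V) (k : ℕ) (c : Sym2 V → Option ℕ) : Prop :=
  AcyclicPartialColoring G c ∧ ∀ e ∈ G.edgeSet, ∃ a, a < k ∧ c e = some a

/-- `G` is 2-degenerate: every nonempty (induced) subgraph has a vertex of degree at most 2. -/
def TwoDegenerate [DecidableEq V] (G : SimpleGraph V) [DecidableRel G.Adj] : Prop :=
  ∀ s : Finset V, s.Nonempty → ∃ v ∈ s, (s.filter fun u => G.Adj v u).card ≤ 2

/-- A maximal `(α,β)`-bichromatic path from `a` to `b`: a path all of whose edges are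
colored `α` or `β`, which cannot be extended at either end. -/
def IsMaximalBichromaticPath (G : SimpleGraph V) (c : Sym2 V → Option ℕ)
    (α β : ℕ) {a b : V} (W : G.Walk a b) : Prop :=
  W.IsPath ∧ (∀ e ∈ W.edges, c e = some α ∨ c e = some β) ∧
  (∀ w, G.Adj a w → (c s(a, w) = some α ∨ c s(a, w) = some β) → w ∈ W.support) ∧
  (∀ w, G.Adj b w → (c s(b, w) = some α ∨ c s(b, w) = some β) → w ∈ W.support)

/-- An `(α,β,a,b)`-maximal bichromatic path: a maximal `(α,β)`-bichromatic path from
`a` to `b` whose edge incident on `a` is colored `α`. -/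
def IsMaxBichromaticPathFrom (G : SimpleGraph V) (c : Sym2 V → Option ℕ)
    (α β : ℕ) {a b : V} (W : G.Walk a b) : Prop :=
  IsMaximalBichromaticPath G c α β W ∧ ∃ e, W.edges.head? = some e ∧ c e = some α

/-- An `(α,β,ab)`-critical path: a maximal `(α,β)`-bichromatic path from `a` to `b` whose
edges incident on `a` and on `b` are both colored `α`. -/
def IsCriticalPath (G : SimpleGraph V) (c : Sym2 V → Option ℕ)
    (α β : ℕ) {a b : V} (W : G.Walk a b) : Prop :=
  IsMaxBichromaticPathFrom G c α β W ∧ ∃ e, W.edges.getLast? = some e ∧ c e = some α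

/-- `F''_x(c)`: colors of edges from `x` to its neighbors (other than `y`) of degree ≥ 3. -/
def Fpp [Fintype V] (G : SimpleGraph V) [DecidableRel G.Adj]
    (c : Sym2 V → Option ℕ) (x y : V) : Set ℕ :=
  {γ | ∃ z, G.Adj x z ∧ z ≠ y ∧ 3 ≤ G.degree z ∧ c s(x, z) = some γ}

/-- `F'_x(c)`: colors of edges from `x` to its neighbors (other than `y`) of degree 2. -/
def Fp [Fintype V] (G : SimpleGraph V) [DecidableRel G.Adj]
    (c : Sym2 V → Option ℕ) (x y : V) : Set ℕ :=
  {γ | ∃ z, G.Adj x z ∧ z ≠ y ∧ G.degree z = 2 ∧ c s(x, z) = some γ}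

/-- `F_x(c) = F'_x(c) ∪ F''_x(c)`. -/
def Fx [Fintype V] (G : SimpleGraph V) [DecidableRel G.Adj]
    (c : Sym2 V → Option ℕ) (x y : V) : Set ℕ :=
  Fp G c x y ∪ Fpp G c x y

section Bichromatic

/-- The spanning subgraph formed by the edges colored `α` or `β`. -/
def bichromatic (c : Sym2 V → Option ℕ) (α β : ℕ) : SimpleGraph V :=
  fromEdgeSet {e | c e = some α ∨ c e = some β}

lemma bichromatic_adj {c : Sym2 V → Option ℕ} {α β : ℕ} {a b : V} :
    (bichromatic c α β).Adj a b ↔ (c s(a, b) = some α ∨ c s(a, b) = some β) ∧ a ≠ b := by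
  simp [bichromatic]

lemma bichromatic_comm (c : Sym2 V → Option ℕ) (α β : ℕ) :
    bichromatic c α β = bichromatic c β α := by
  ext a b
  simp only [bichromatic_adj, or_comm]

lemma bichromatic_mono {c d : Sym2 V → Option ℕ} {α β : ℕ}
    (h : ∀ e a, a = α ∨ a = β → c e = some a → d e = some a) :
    bichromatic c α β ≤ bichromatic d α β := by
  intro a b
  simp only [bichromatic_adj]
  exact fun hab => ⟨hab.1.imp (h _ _ (.inl rfl)) (h _ _ (.inr rfl)), hab.2⟩

/-- No edge at `a` has color `β`. -/
def Missing (c : Sym2 V → Option ℕ) (a : V) (β : ℕ) : Prop :=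
  ∀ z, c s(a, z) ≠ some β

/-- `c` is an acyclic coloring, with colors `< k`, of precisely the edges of `G` outside `S`. -/
structure ColorsOff (G : SimpleGraph V) (k : ℕ) (S : Set (Sym2 V))
    (c : Sym2 V → Option ℕ) : Prop where
  supp : ∀ e a, c e = some a → e ∈ G.edgeSet ∧ e ∉ S ∧ a < k
  total : ∀ e ∈ G.edgeSet, e ∉ S → ∃ a, c e = some a
  proper : ∀ u v w a, c s(u, v) = some a → c s(u, w) = some a → v = w
  acyclic : ∀ α β, (bichromatic c α β).IsAcyclic

variable {G : SimpleGraph V} {k : ℕ} {S : Set (Sym2 V)} {c : Sym2 V → Option ℕ}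

lemma IsAcyclicEdgeColoring.colorsOff
    (h : IsAcyclicEdgeColoring (G.deleteEdges S) k c) : ColorsOff G k S c := by
  obtain ⟨⟨⟨hs, hp⟩, ha⟩, ht⟩ := h
  have hmem : ∀ e a, c e = some a → e ∈ (G.deleteEdges S).edgeSet :=
    fun e a he => hs e (by simp [he])
  refine ⟨fun e a he => ?_, fun e he heS => ?_, fun u v w a hv hw => ?_, fun α β v W hW => ?_⟩
  · obtain ⟨b, hb, heb⟩ := ht e (hmem e a he)
    obtain rfl : a = b := by simpa [he] using heb
    have := hmem e a he
    rw [edgeSet_deleteEdges] at this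
    exact ⟨this.1, this.2, hb⟩
  · obtain ⟨a, -, h⟩ := ht e (by rw [edgeSet_deleteEdges]; exact ⟨he, heS⟩)
    exact ⟨a, h⟩
  · by_contra hvw
    exact hp (hmem _ _ hv) (hmem _ _ hw) hvw (by simp [hv]) (hv.trans hw.symm)
  · have hle : bichromatic c α β ≤ G.deleteEdges S := fun a b hab =>
      (bichromatic_adj.1 hab).1.elim (hmem _ _) (hmem _ _)
    refine ha α β v (W.mapLe hle) (hW.mapLe hle) fun e he => ?_
    rw [Walk.edges_mapLe_eq_edges] at he
    have := W.edges_subset_edgeSet he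
    induction e with
    | _ a b => exact (bichromatic_adj.1 this).1

lemma ColorsOff.isAcyclicEdgeColoring (h : ColorsOff G k ∅ c) :
    IsAcyclicEdgeColoring G k c := by
  refine ⟨⟨⟨fun e he => ?_, fun u v w hv hw hvw hs heq => ?_⟩, fun α β v W hW hcol => ?_⟩,
    fun e he => ?_⟩
  · obtain ⟨a, ha⟩ := Option.isSome_iff_exists.1 he
    exact (h.supp e a ha).1
  · obtain ⟨a, ha⟩ := Option.isSome_iff_exists.1 hs
    exact hvw (h.proper u v w a ha (heq ▸ ha))
  · have hmem : ∀ e ∈ W.edges, e ∈ (bichromatic c α β).edgeSet := by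
      intro e he
      have hG := W.edges_subset_edgeSet he
      have := hcol e he
      induction e with
      | _ a b => exact bichromatic_adj.2 ⟨this, hG.ne⟩
    exact h.acyclic α β _ (hW.transfer hmem)
  · obtain ⟨a, ha⟩ := h.total e he (by simp)
    exact ⟨a, (h.supp e a ha).2.2, ha⟩

namespace ColorsOff

lemma adj (h : ColorsOff G k S c) {a b : V} {α : ℕ} (hab : c s(a, b) = some α) : G.Adj a b :=
  (h.supp _ _ hab).1

lemma apply_eq_none (h : ColorsOff G k S c) {e : Sym2 V} (he : e ∈ S) : c e = none := by
  by_contra hne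
  obtain ⟨a, ha⟩ := Option.ne_none_iff_exists'.1 hne
  exact (h.supp e a ha).2.1 he

variable [DecidableEq V]

/-- Removing the color of an edge. -/
lemma uncolor (h : ColorsOff G k S c) (e : Sym2 V) :
    ColorsOff G k (insert e S) (Function.update c e none) := by
  have hle : ∀ f a, Function.update c e none f = some a → f ≠ e ∧ c f = some a := by
    intro f a hf
    by_cases hfe : f = e
    · simp [hfe] at hf
    · exact ⟨hfe, by rwa [Function.update_of_ne hfe] at hf⟩
  refine ⟨fun f a hf => ?_, fun f hf hfS => ?_, fun u v w a hv hw => ?_, fun α β => ?_⟩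
  · obtain ⟨hfe, hf⟩ := hle f a hf
    obtain ⟨h1, h2, h3⟩ := h.supp f a hf
    exact ⟨h1, by simp [hfe, h2], h3⟩
  · simp only [Set.mem_insert_iff, not_or] at hfS
    rw [Function.update_of_ne hfS.1]
    exact h.total f hf hfS.2
  · exact h.proper u v w a (hle _ _ hv).2 (hle _ _ hw).2
  · exact (h.acyclic α β).anti (bichromatic_mono fun f a _ hf => (hle f a hf).2)

/-- Coloring an edge whose endpoints are not joined by a bichromatic path. -/
lemma color {x y : V} {β : ℕ} (h : ColorsOff G k (insert s(x, y) S) c) (hxy : G.Adj x y)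
    (hS : s(x, y) ∉ S) (hβ : β < k) (hx : Missing c x β) (hy : Missing c y β)
    (hr : ∀ α, ¬ (bichromatic c α β).Reachable x y) :
    ColorsOff G k S (Function.update c s(x, y) (some β)) := by
  have hup : ∀ f a, Function.update c s(x, y) (some β) f = some a →
      f = s(x, y) ∧ a = β ∨ f ≠ s(x, y) ∧ c f = some a := by
    intro f a hf
    by_cases hfe : f = s(x, y)
    · subst hfe
      left; simpa [eq_comm] using hf
    · exact .inr ⟨hfe, by rwa [Function.update_of_ne hfe] at hf⟩
  have hcyc : ∀ α, (bichromatic (Function.update c s(x, y) (some β)) α β).IsAcyclic := by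
    intro α
    refine ((h.acyclic α β).sup_edge_of_not_reachable (hr α)).anti fun a b hab => ?_
    rw [bichromatic_adj] at hab
    rw [sup_adj, adj_edge, bichromatic_adj]
    rcases hab with ⟨hab | hab, hne⟩ <;> rcases hup _ _ hab with h' | h'
    · exact .inr ⟨h'.1.symm, hne⟩
    · exact .inl ⟨.inl h'.2, hne⟩
    · exact .inr ⟨h'.1.symm, hne⟩
    · exact .inl ⟨.inr h'.2, hne⟩
  have hmiss : ∀ u v w, s(u, v) = s(x, y) → c s(u, w) ≠ some β := by
    intro u v w huv
    rcases Sym2.eq_iff.1 huv with ⟨rfl, rfl⟩ | ⟨rfl, rfl⟩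
    exacts [hx w, hy w]
  refine ⟨fun f a hf => ?_, fun f hf hfS => ?_, fun u v w a hv hw => ?_, fun α α' => ?_⟩
  · rcases hup f a hf with ⟨rfl, rfl⟩ | ⟨hfe, hf⟩
    · exact ⟨hxy, hS, hβ⟩
    · obtain ⟨h1, h2, h3⟩ := h.supp f a hf
      exact ⟨h1, fun h' => h2 (.inr h'), h3⟩
  · by_cases hfe : f = s(x, y)
    · exact ⟨β, by simp [hfe]⟩
    · rw [Function.update_of_ne hfe]
      exact h.total f hf (by simp [hfe, hfS])
  · rcases hup _ _ hv with ⟨hv', h1⟩ | ⟨-, hv'⟩ <;>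
      rcases hup _ _ hw with ⟨hw', h2⟩ | ⟨-, hw'⟩
    · exact Sym2.congr_right.1 (hv'.trans hw'.symm)
    · exact (hmiss _ _ _ hv' (h1 ▸ hw')).elim
    · exact (hmiss _ _ _ hw' (h2 ▸ hv')).elim
    · exact h.proper u v w a hv' hw'
  · by_cases h2 : α' = β
    · exact h2 ▸ hcyc α
    by_cases h1 : α = β
    · rw [bichromatic_comm, h1]
      exact hcyc α'
    · refine (h.acyclic α α').anti (bichromatic_mono fun f a ha hf => ?_)
      rcases hup f a hf with ⟨-, rfl⟩ | ⟨-, hf⟩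
      · rcases ha with rfl | rfl <;> contradiction
      · exact hf

end ColorsOff

end Bichromatic

section Walks

variable {H : SimpleGraph V}

lemma exists_path_step {a b : V} (p : H.Walk a b) (hp : p.IsPath) (hab : a ≠ b) :
    ∃ t ∈ p.support, H.Adj a t ∧ ∃ q : H.Walk t b, q.IsPath ∧ a ∉ q.support := by
  cases p with
  | nil => exact (hab rfl).elim
  | cons h q =>
    rw [Walk.cons_isPath_iff] at hp
    exact ⟨_, by simp, h, q, hp⟩

lemma exists_path_step_of_reachable {a b : V} (h : H.Reachable a b) (hab : a ≠ b) :
    ∃ t, H.Adj a t ∧ ∃ q : H.Walk t b, q.IsPath ∧ a ∉ q.support := by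
  obtain ⟨p, hp⟩ := h.exists_isPath
  obtain ⟨t, -, ht⟩ := exists_path_step p hp hab
  exact ⟨t, ht⟩

/-- In a graph of maximum degree two, two paths that leave a common vertex in the same direction
and end in vertices of degree one have the same end. -/
lemma path_end_unique
    (hdeg : ∀ a b₁ b₂ b₃, H.Adj a b₁ → H.Adj a b₂ → H.Adj a b₃ → b₁ = b₂ ∨ b₁ = b₃ ∨ b₂ = b₃)
    {a b y w : V} (p : H.Walk a y) (q : H.Walk a w) (hp : p.IsPath) (hq : q.IsPath)
    (hab : H.Adj a b) (hbp : b ∉ p.support) (hbq : b ∉ q.support)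
    (hy : ∀ s t, H.Adj y s → H.Adj y t → s = t) (hw : ∀ s t, H.Adj w s → H.Adj w t → s = t) :
    y = w := by
  induction p generalizing b with
  | nil =>
    cases q with
    | nil => rfl
    | cons h q' =>
      obtain rfl := hy _ _ hab h
      simp at hbq
  | cons h p' ih =>
    cases q with
    | nil =>
      obtain rfl := hw _ _ hab h
      simp at hbp
    | cons h' q' =>
      rw [Walk.cons_isPath_iff] at hp hq
      simp only [Walk.support_cons, List.mem_cons, not_or] at hbp hbq
      rcases hdeg _ _ _ _ hab h h' with rfl | rfl | rfl
      · simp at hbp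
      · simp at hbq
      · exact ih q' hp.1 hq.1 h.symm hp.2 hq.2 hy

/-- In a graph of maximum degree two, a component contains at most two vertices of degree one. -/
lemma leaf_unique
    (hdeg : ∀ a b₁ b₂ b₃, H.Adj a b₁ → H.Adj a b₂ → H.Adj a b₃ → b₁ = b₂ ∨ b₁ = b₃ ∨ b₂ = b₃)
    {x y w : V} (hxy : H.Reachable x y) (hxw : H.Reachable x w) (hy' : x ≠ y) (hw' : x ≠ w)
    (hx : ∀ s t, H.Adj x s → H.Adj x t → s = t)
    (hy : ∀ s t, H.Adj y s → H.Adj y t → s = t) (hw : ∀ s t, H.Adj w s → H.Adj w t → s = t) :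
    y = w := by
  obtain ⟨a, ha, p, hp, hxp⟩ := exists_path_step_of_reachable hxy hy'
  obtain ⟨b, hb, q, hq, hxq⟩ := exists_path_step_of_reachable hxw hw'
  obtain rfl := hx _ _ ha hb
  exact path_end_unique hdeg p q hp hq ha.symm hxp hxq hy hw

lemma bichromatic_degree_le_two {c : Sym2 V → Option ℕ}
    (hc : ∀ u v w a, c s(u, v) = some a → c s(u, w) = some a → v = w) (α β : ℕ)
    (a b₁ b₂ b₃ : V) (h₁ : (bichromatic c α β).Adj a b₁) (h₂ : (bichromatic c α β).Adj a b₂)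
    (h₃ : (bichromatic c α β).Adj a b₃) : b₁ = b₂ ∨ b₁ = b₃ ∨ b₂ = b₃ := by
  rw [bichromatic_adj] at h₁ h₂ h₃
  have := hc a
  grind

/-- A bichromatic path leaving `x` along color `α` only continues with color `β`. -/
lemma exists_next_edge {c : Sym2 V → Option ℕ}
    (hc : ∀ u v w a, c s(u, v) = some a → c s(u, w) = some a → v = w) {α β : ℕ} {x y u : V}
    (hr : (bichromatic c α β).Reachable x y) (hx : Missing c x β) (hu : c s(x, u) = some α)
    (hxy : x ≠ y) (huy : u ≠ y) : ∃ t, c s(u, t) = some β := by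
  obtain ⟨a, ha, p, hp, hxp⟩ := exists_path_step_of_reachable hr hxy
  obtain rfl : a = u := hc _ _ _ _ ((bichromatic_adj.1 ha).1.resolve_right (hx a)) hu
  obtain ⟨t, htp, ht, -⟩ := exists_path_step p hp huy
  refine ⟨t, (bichromatic_adj.1 ht).1.resolve_left fun h => hxp ?_⟩
  rwa [hc a x t α (Sym2.eq_swap ▸ hu) h]

end Walks

namespace ColorsOff

section Finite

variable {G : SimpleGraph V} {k : ℕ} {S : Set (Sym2 V)} {c : Sym2 V → Option ℕ}

lemma exists_missing (a : V) (N : Finset V) (hN : ∀ z α, c s(a, z) = some α → z ∈ N)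
    (T : Finset ℕ) (hk : N.card + T.card < k) : ∃ β < k, β ∉ T ∧ Missing c a β := by
  classical
  have hcard : ((N.image fun z => (c s(a, z)).getD 0) ∪ T).card < (Finset.range k).card := by
    rw [Finset.card_range]
    exact (Finset.card_union_le _ _).trans_lt
      ((Nat.add_le_add_right Finset.card_image_le _).trans_lt hk)
  obtain ⟨β, hβ, hβ'⟩ := Finset.exists_mem_notMem_of_card_lt_card hcard
  rw [Finset.mem_union, not_or] at hβ'
  exact ⟨β, Finset.mem_range.1 hβ, hβ'.2,
    fun z hz => hβ'.1 (Finset.mem_image.2 ⟨z, hN z β hz, by simp [hz]⟩)⟩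

/-- Recoloring the only colored edge at `y`. -/
lemma recolor [DecidableEq V] {y y' : V} {μ : ℕ} (h : ColorsOff G k S c) (hμ : c s(y, y') = some μ)
    (hyc : ∀ z a, c s(y, z) = some a → z = y') {ν : ℕ} (hν : ν < k) (hm : Missing c y' ν) :
    ColorsOff G k S (Function.update c s(y, y') (some ν)) := by
  have hle : ∀ f a, Function.update c s(y, y') none f = some a → f ≠ s(y, y') ∧ c f = some a := by
    intro f a hf
    by_cases hfe : f = s(y, y')
    · simp [hfe] at hf
    · exact ⟨hfe, by rwa [Function.update_of_ne hfe] at hf⟩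
  have hy : ∀ a, Missing (Function.update c s(y, y') none) y a := by
    intro a z hz
    exact (hle _ _ hz).1 (by rw [hyc _ _ (hle _ _ hz).2])
  have := (h.uncolor s(y, y')).color (h.adj hμ) (h.supp _ _ hμ).2.1 hν (hy ν)
    (fun z hz => hm z (hle _ _ hz).2) fun α hα => by
      obtain ⟨t, ht, -⟩ := exists_path_step_of_reachable hα (h.adj hμ).ne
      exact (bichromatic_adj.1 ht).1.elim (hy _ _) (hy _ _)
  rwa [Function.update_idem] at this

variable [Fintype V] [DecidableRel G.Adj]

lemma eq_of_degree_le_two {x y z z' : V} (hy : G.degree y ≤ 2) (hx : G.Adj y x)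
    (hz : G.Adj y z) (hz' : G.Adj y z') (hzx : z ≠ x) (hzx' : z' ≠ x) : z = z' := by
  classical
  by_contra hne
  have hsub : ({x, z, z'} : Finset V) ⊆ G.neighborFinset y := by
    intro t ht
    simp only [Finset.mem_insert, Finset.mem_singleton] at ht
    rcases ht with rfl | rfl | rfl <;> simpa
  have := Finset.card_le_card hsub
  rw [Finset.card_eq_three.2 ⟨x, z, z', hzx.symm, hzx'.symm, hne, rfl⟩,
    card_neighborFinset_eq_degree] at this
  omega

lemma exists_missing_of_degree_lt (h : ColorsOff G k S c) (a : V) (ha : G.degree a < k) :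
    ∃ β < k, Missing c a β := by
  obtain ⟨β, hβ, -, hm⟩ := exists_missing (c := c) (k := k) a (G.neighborFinset a)
    (fun z α hz => by simpa using h.adj hz) ∅ (by simpa using ha)
  exact ⟨β, hβ, hm⟩

lemma leaf_of_degree_le_two {x y : V} (h : ColorsOff G k S c) {α β : ℕ} (hy : G.degree y ≤ 2)
    (hxy : G.Adj x y) (hα : c s(x, y) ≠ some α) (hβ : c s(x, y) ≠ some β) (s t : V)
    (hs : (bichromatic c α β).Adj y s) (ht : (bichromatic c α β).Adj y t) : s = t := by
  have hne : ∀ z, (bichromatic c α β).Adj y z → G.Adj y z ∧ z ≠ x := by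
    intro z hz
    have hz := (bichromatic_adj.1 hz).1
    refine ⟨hz.elim h.adj h.adj, ?_⟩
    rintro rfl
    rw [Sym2.eq_swap] at hz
    exact hz.elim hα hβ
  exact eq_of_degree_le_two hy hxy.symm (hne s hs).1 (hne t ht).1 (hne s hs).2 (hne t ht).2

/-- If color `β` at `x` sits on `xw`, then two critical paths for the same colors starting at `x`,
one ending at `y` before and one ending at `w` after moving `β` from `xw` to `xy`, cannot both
exist. -/
lemma not_reachable_both {x y w : V} (h : ColorsOff G (G.maxDegree + 1) {s(x, y)} c)
    {d : Sym2 V → Option ℕ} {α δ : ℕ} (hxy : G.Adj x y) (hy : G.degree y ≤ 2) (hw : G.degree w ≤ 2)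
    (hwy : w ≠ y) (hxw : G.Adj x w) (hα : c s(x, w) ≠ some α) (hδ : c s(x, w) ≠ some δ)
    (hx : Missing c x δ) (hd : ∀ e a, a = α ∨ a = δ → d e = some a → c e = some a)
    (hry : (bichromatic c α δ).Reachable x y) (hrw : (bichromatic d α δ).Reachable x w) :
    False := by
  refine hwy (leaf_unique (bichromatic_degree_le_two h.proper α δ) hry
    (hrw.mono (bichromatic_mono hd)) hxy.ne hxw.ne (fun s t hs ht => ?_) ?_ ?_).symm
  · exact h.proper x s t α ((bichromatic_adj.1 hs).1.resolve_right (hx s))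
      ((bichromatic_adj.1 ht).1.resolve_right (hx t))
  · exact h.leaf_of_degree_le_two hy hxy (by simp [h.apply_eq_none]) (by simp [h.apply_eq_none])
  · exact h.leaf_of_degree_le_two hw hxw hα hδ

variable [DecidableEq V] {x y y' : V} {μ ν : ℕ}

lemma exists_missing_ne (h : ColorsOff G (G.maxDegree + 1) S c) (hxy : G.Adj x y)
    (hS : s(x, y) ∈ S) (δ : ℕ) : ∃ β < G.maxDegree + 1, β ≠ δ ∧ Missing c x β := by
  have hy : y ∈ G.neighborFinset x := by simpa
  obtain ⟨β, hβ, hδ, hm⟩ := exists_missing (c := c) (k := G.maxDegree + 1) x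
    ((G.neighborFinset x).erase y) (fun z α hz => by
      refine Finset.mem_erase.2 ⟨?_, by simpa using h.adj hz⟩
      rintro rfl
      simp [h.apply_eq_none hS] at hz) {δ} (by
      have h1 := Finset.card_erase_add_one hy
      have h2 := G.degree_le_maxDegree x
      rw [card_neighborFinset_eq_degree] at h1
      rw [Finset.card_singleton]
      omega)
  exact ⟨β, hβ, by simpa using hδ, hm⟩

lemma reachable_of_missing (hext : ∀ d, ¬ ColorsOff G (G.maxDegree + 1) ∅ d)
    (h : ColorsOff G (G.maxDegree + 1) {s(x, y)} c) (hxy : G.Adj x y)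
    (hyc : ∀ z a, c s(y, z) = some a → a = μ) {β : ℕ} (hβ : β < G.maxDegree + 1)
    (hx : Missing c x β) (hβμ : β ≠ μ) : (bichromatic c μ β).Reachable x y := by
  by_contra hr
  refine hext _ (ColorsOff.color (S := ∅) (by simpa using h) hxy (by simp) hβ hx
    (fun z hz => hβμ (hyc z β hz)) fun α hα => ?_)
  obtain ⟨t, ht, -⟩ := exists_path_step_of_reachable hα.symm hxy.ne'
  rcases (bichromatic_adj.1 ht).1 with ht | ht
  · exact hr (hyc t _ ht ▸ hα)
  · exact hβμ (hyc t _ ht)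

lemma exists_unique_edge (hext : ∀ d, ¬ ColorsOff G (G.maxDegree + 1) ∅ d)
    (h : ColorsOff G (G.maxDegree + 1) {s(x, y)} c) (hxy : G.Adj x y)
    (hy : G.degree y ≤ 2) :
    ∃ y' μ, c s(y, y') = some μ ∧ ∀ z a, c s(y, z) = some a → z = y' ∧ a = μ := by
  have hne : ∀ z a, c s(y, z) = some a → z ≠ x := by
    rintro z a hz rfl
    simp [Sym2.eq_swap, h.apply_eq_none] at hz
  by_cases hex : ∃ y' μ, c s(y, y') = some μ
  · obtain ⟨y', μ, hμ⟩ := hex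
    refine ⟨y', μ, hμ, fun z a hz => ?_⟩
    obtain rfl := eq_of_degree_le_two hy hxy.symm (h.adj hz) (h.adj hμ) (hne _ _ hz) (hne _ _ hμ)
    exact ⟨rfl, by simpa [hz] using hμ⟩
  · push Not at hex
    obtain ⟨β, hβ, -, hm⟩ := h.exists_missing_ne hxy rfl 0
    have hr := h.reachable_of_missing hext hxy (μ := β + 1)
      (fun z a hz => (hex z a hz).elim) hβ hm (by omega)
    obtain ⟨t, ht, -⟩ := exists_path_step_of_reachable hr.symm hxy.ne'
    rcases (bichromatic_adj.1 ht).1 with ht | ht <;> exact (hex _ _ ht).elim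

/-- The color `μ` at `y` also occurs at `x`, on an edge to a vertex of degree at least three. -/
lemma exists_large_neighbor (hext : ∀ d, ¬ ColorsOff G (G.maxDegree + 1) ∅ d)
    (h : ColorsOff G (G.maxDegree + 1) {s(x, y)} c) (hxy : G.Adj x y)
    (hyc : ∀ z a, c s(y, z) = some a → a = μ) :
    ∃ u, c s(x, u) = some μ ∧ 3 ≤ G.degree u := by
  obtain ⟨β, hβ, hβμ, hm⟩ := h.exists_missing_ne hxy rfl μ
  have hr := h.reachable_of_missing hext hxy hyc hβ hm hβμ
  obtain ⟨u, hu, -⟩ := exists_path_step_of_reachable hr hxy.ne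
  have hxu := (bichromatic_adj.1 hu).1.resolve_right (hm u)
  obtain ⟨β', hβ', hne, hm'⟩ := h.exists_missing_ne hxy rfl β
  have hβμ' : β' ≠ μ := fun h' => hm' u (h' ▸ hxu)
  have hr' := h.reachable_of_missing hext hxy hyc hβ' hm' hβμ'
  have huy : u ≠ y := by
    rintro rfl
    simp [h.apply_eq_none] at hxu
  obtain ⟨t, ht⟩ := exists_next_edge h.proper hr hm hxu hxy.ne huy
  obtain ⟨t', ht'⟩ := exists_next_edge h.proper hr' hm' hxu hxy.ne huy
  refine ⟨u, hxu, ?_⟩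
  by_contra! hlt
  have hxt : t ≠ x := by
    rintro rfl
    exact hm u (Sym2.eq_swap ▸ ht)
  have hxt' : t' ≠ x := by
    rintro rfl
    exact hm' u (Sym2.eq_swap ▸ ht')
  obtain rfl := eq_of_degree_le_two (by omega) (h.adj hxu).symm (h.adj ht) (h.adj ht') hxt hxt'
  exact hne (by simpa [ht] using ht'.symm)

/-- For every color `β` besides `μ` and a color `ν` missing at `y'`, there is a critical path from
`x` to `y` once `β` is removed at `x`. -/
lemma exists_critical (hext : ∀ d, ¬ ColorsOff G (G.maxDegree + 1) ∅ d)
    (h : ColorsOff G (G.maxDegree + 1) {s(x, y)} c) (hxy : G.Adj x y)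
    (hy : G.degree y ≤ 2) (hyx : y' ≠ x) (hμ : c s(y, y') = some μ)
    (hyc : ∀ z a, c s(y, z) = some a → z = y' ∧ a = μ)
    (hlarge : ((G.neighborFinset x).filter fun z => 3 ≤ G.degree z).card ≤ 2)
    (hν : ν < G.maxDegree + 1) (hm : Missing c y' ν)
    {β : ℕ} (hβ : β < G.maxDegree + 1) (hβμ : β ≠ μ) (hβν : β ≠ ν) :
    ∃ d : Sym2 V → Option ℕ, (∀ e a, d e = some a → c e = some a) ∧ Missing d x β ∧
      (bichromatic d μ β).Reachable x y := by
  by_cases hxβ : Missing c x β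
  · exact ⟨c, fun _ _ => id, hxβ,
      h.reachable_of_missing hext hxy (fun z a hz => (hyc z a hz).2) hβ hxβ hβμ⟩
  simp only [Missing, not_forall, not_not, ne_eq] at hxβ
  obtain ⟨w, hw⟩ := hxβ
  have hadj := h.adj hw
  have hyμ : ν ≠ μ := by
    rintro rfl
    exact hm y (Sym2.eq_swap ▸ hμ)
  have hxe : ∀ z, s(x, z) ≠ s(y, y') := by
    intro z hz
    rcases Sym2.eq_iff.1 hz with ⟨hz, -⟩ | ⟨hz, -⟩
    · exact hxy.ne hz
    · exact hyx hz.symm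
  have hwy : w ≠ y := by
    rintro rfl
    simp [h.apply_eq_none] at hw
  have h₁ := h.recolor hμ (fun z a hz => (hyc z a hz).1) hν hm
  set c₁ := Function.update c s(y, y') (some ν) with hc₁
  have hc₁x : ∀ z, c₁ s(x, z) = c s(x, z) := fun z => Function.update_of_ne (hxe z) _ _
  have hyc₁ : ∀ z a, c₁ s(y, z) = some a → a = ν := by
    intro z a hz
    by_cases hzy : s(y, z) = s(y, y')
    · simpa [hc₁, hzy, eq_comm] using hz
    · rw [hc₁, Function.update_of_ne hzy] at hz
      exact (hzy (by rw [(hyc z a hz).1])).elim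
  obtain ⟨u, hu, hu3⟩ := h.exists_large_neighbor hext hxy fun z a hz => (hyc z a hz).2
  obtain ⟨v, hv, hv3⟩ := h₁.exists_large_neighbor hext hxy hyc₁
  rw [hc₁x] at hv
  have hlarge' : ∀ z, G.Adj x z → 3 ≤ G.degree z → z = u ∨ z = v := by
    intro z hz hz3
    by_contra! hne
    have huv : u ≠ v := by
      rintro rfl
      exact hyμ (by simpa [hu, eq_comm] using hv)
    have hsub : ({z, u, v} : Finset V) ⊆
        (G.neighborFinset x).filter fun z => 3 ≤ G.degree z := by
      intro t ht
      simp only [Finset.mem_insert, Finset.mem_singleton] at ht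
      rcases ht with rfl | rfl | rfl <;> simp [*, h.adj hu, h.adj hv]
    have := Finset.card_le_card hsub
    rw [Finset.card_eq_three.2 ⟨z, u, v, hne.1, hne.2, huv, rfl⟩] at this
    omega
  have hw2 : G.degree w ≤ 2 := by
    by_contra! hw3
    rcases hlarge' w hadj hw3 with rfl | rfl
    · exact hβμ (by simpa [hw] using hu)
    · exact hβν (by simpa [hw] using hv)
  have h₂ := h.uncolor s(x, w)
  set d := Function.update c s(x, w) none with hd
  have hdc : ∀ e a, d e = some a → c e = some a := by
    intro e a he
    by_cases hew : e = s(x, w)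
    · simp [hd, hew] at he
    · rwa [hd, Function.update_of_ne hew] at he
  have hdβ : Missing d x β := by
    intro z hz
    rw [h.proper _ _ _ _ (hdc _ _ hz) hw] at hz
    simp [hd] at hz
  refine ⟨d, hdc, hdβ, ?_⟩
  by_contra hr
  have hdy : ∀ z a, d s(y, z) = some a → a = μ := fun z a hz => (hyc z a (hdc _ _ hz)).2
  have h₃ := ColorsOff.color (x := x) (y := y) (S := {s(x, w)}) (Set.pair_comm _ _ ▸ h₂) hxy
    (by simpa [hxy.ne, hadj.ne] using hwy.symm) hβ hdβ (fun z hz => hβμ (hdy _ _ hz)) fun α hα => by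
      obtain ⟨t, ht, -⟩ := exists_path_step_of_reachable hα.symm hxy.ne'
      rcases (bichromatic_adj.1 ht).1 with ht | ht
      · exact hr (hdy t _ ht ▸ hα)
      · exact hβμ (hdy t _ ht)
  set e := Function.update d s(x, y) (some β) with he
  have hec : ∀ f a, f ≠ s(x, y) ∨ a ≠ β → e f = some a → c f = some a := by
    intro f a hfa hf
    by_cases hfe : f = s(x, y)
    · subst hfe
      exact absurd (by simpa [he, eq_comm] using hf) (hfa.resolve_left (by simp))
    · exact hdc _ _ (by rwa [he, Function.update_of_ne hfe] at hf)
  obtain ⟨w', ε, -, hwε⟩ := h₃.exists_unique_edge hext hadj hw2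
  obtain ⟨z, hz, hz3⟩ := h₃.exists_large_neighbor hext hadj fun t a ht => (hwε t a ht).2
  have hzc := hec _ _ (.inl fun hzy => by
    rw [Sym2.congr_right] at hzy
    subst hzy
    omega) hz
  have hε : ε = μ ∨ ε = ν := by
    rcases hlarge' z (h.adj hzc) hz3 with rfl | rfl
    · exact .inl (by simpa [hzc] using hu)
    · exact .inr (by simpa [hzc] using hv)
  obtain ⟨δ, hδ, -, hδx⟩ := h.exists_missing_ne hxy rfl 0
  have hδβ : δ ≠ β := fun h' => hδx w (h' ▸ hw)
  have hδμ : δ ≠ μ := fun h' => hδx u (h' ▸ hu)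
  have hδν : δ ≠ ν := fun h' => hδx v (h' ▸ hv)
  have hrw := h₃.reachable_of_missing hext hadj (fun t a ht => (hwε t a ht).2) hδ
    (fun t ht => hδx t (hec _ _ (.inr hδβ) ht)) (by rcases hε with rfl | rfl <;> assumption)
  rcases hε with rfl | rfl
  · refine h.not_reachable_both hxy hy hw2 hwy hadj (by simpa [hw]) (by simpa [hw] using hδβ.symm)
      hδx (fun f a ha => hec f a (.inr ?_))
      (h.reachable_of_missing hext hxy (fun z a hz => (hyc z a hz).2) hδ hδx hδμ) hrw
    rcases ha with rfl | rfl
    exacts [hβμ.symm, hδβ]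
  · have hδx₁ : Missing c₁ x δ := fun t ht => hδx t (hc₁x t ▸ ht)
    refine h₁.not_reachable_both hxy hy hw2 hwy hadj (by simpa [hc₁x, hw])
      (by simpa [hc₁x, hw] using hδβ.symm) hδx₁ (fun f a ha hf => ?_)
      (h₁.reachable_of_missing hext hxy hyc₁ hδ hδx₁ hδν) hrw
    have hfc := hec f a (.inr (by rcases ha with rfl | rfl; exacts [hβν.symm, hδβ])) hf
    rw [hc₁, Function.update_of_ne, hfc]
    rintro rfl
    rw [hμ, Option.some_inj] at hfc
    subst hfc
    rcases ha with rfl | rfl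
    exacts [hyμ rfl, hδμ rfl]

/-- A color missing at `y'` is also missing at `u`, if `u` is the neighbor of `x` with the color
of `yy'`. -/
lemma missing_of_missing (hext : ∀ d, ¬ ColorsOff G (G.maxDegree + 1) ∅ d)
    (h : ColorsOff G (G.maxDegree + 1) {s(x, y)} c) (hxy : G.Adj x y)
    (hy : G.degree y ≤ 2) (hyx : y' ≠ x) (hμ : c s(y, y') = some μ)
    (hyc : ∀ z a, c s(y, z) = some a → z = y' ∧ a = μ)
    (hlarge : ((G.neighborFinset x).filter fun z => 3 ≤ G.degree z).card ≤ 2)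
    (hν : ν < G.maxDegree + 1) (hm : Missing c y' ν) {u : V} (hu : c s(x, u) = some μ) :
    Missing c u ν := by
  intro t ht
  obtain ⟨β, hβ, hβu⟩ := h.exists_missing_of_degree_lt u (by
    have := G.degree_le_maxDegree u
    omega)
  have hβμ : β ≠ μ := by
    rintro rfl
    exact hβu x (Sym2.eq_swap ▸ hu)
  have hβν : β ≠ ν := fun h' => hβu t (h' ▸ ht)
  obtain ⟨d, hdc, hdx, hr⟩ :=
    h.exists_critical hext hxy hy hyx hμ hyc hlarge hν hm hβ hβμ hβν
  have hdp : ∀ u v w a, d s(u, v) = some a → d s(u, w) = some a → v = w :=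
    fun _ _ _ _ h₁ h₂ => h.proper _ _ _ _ (hdc _ _ h₁) (hdc _ _ h₂)
  obtain ⟨a, ha, -⟩ := exists_path_step_of_reachable hr hxy.ne
  have hda := (bichromatic_adj.1 ha).1.resolve_right (hdx a)
  obtain rfl := h.proper _ _ _ _ (hdc _ _ hda) hu
  have hay : a ≠ y := by
    rintro rfl
    simp [h.apply_eq_none] at hu
  obtain ⟨s, hs⟩ := exists_next_edge hdp hr hdx hda hxy.ne hay
  exact hβu s (hdc _ _ hs)

/-- If `xu` and `yy'` have the same color, then `u` and `y'` are not adjacent. -/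
lemma ne_some_of_eq_color (hext : ∀ d, ¬ ColorsOff G (G.maxDegree + 1) ∅ d)
    (h : ColorsOff G (G.maxDegree + 1) {s(x, y)} c)
    (hxy : G.Adj x y) (hy : G.degree y ≤ 2) (hyx : y' ≠ x) (hμ : c s(y, y') = some μ)
    (hlarge : ((G.neighborFinset x).filter fun z => 3 ≤ G.degree z).card ≤ 2)
    {u : V} (hu : c s(x, u) = some μ) (γ : ℕ) : c s(u, y') ≠ some γ := by
  intro hγ
  obtain ⟨y₁, μ₁, hμ₁, hyc⟩ := h.exists_unique_edge hext hxy hy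
  obtain ⟨rfl, rfl⟩ := hyc y' μ hμ
  obtain ⟨ν, hν, hm⟩ := h.exists_missing_of_degree_lt y' (by
    have := G.degree_le_maxDegree y'
    omega)
  have hmu := h.missing_of_missing hext hxy hy hyx hμ hyc hlarge hν hm hu
  have huy : u ≠ y := by
    rintro rfl
    simp [h.apply_eq_none] at hu
  have hγμ : γ ≠ μ := by
    rintro rfl
    have := h.proper y' y u γ (Sym2.eq_swap ▸ hμ) (Sym2.eq_swap ▸ hγ)
    exact huy this.symm
  have hγν : γ ≠ ν := fun h' => hmu y' (h' ▸ hγ)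
  have h₁ := h.recolor hμ (fun z a hz => (hyc z a hz).1) hν hm
  set c₁ := Function.update c s(y, y') (some ν) with hc₁
  have hne : ∀ e, e ≠ s(y, y') → c₁ e = c e := fun e he => Function.update_of_ne he _ _
  have hyy : c₁ s(y, y') = some ν := Function.update_self ..
  have hyc₁ : ∀ z a, c₁ s(y, z) = some a → z = y' ∧ a = ν := by
    intro z a hz
    by_cases hzy : s(y, z) = s(y, y')
    · rw [hzy, hyy, Option.some_inj] at hz
      exact ⟨Sym2.congr_right.1 hzy, hz.symm⟩
    · rw [hne _ hzy] at hz
      exact (hzy (by rw [(hyc z a hz).1])).elim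
  have hm₁ : Missing c₁ y' μ := by
    intro z hz
    by_cases hzy : s(y', z) = s(y, y')
    · rw [hzy, hyy, Option.some_inj] at hz
      exact hm y (by rw [hz, Sym2.eq_swap, hμ])
    · rw [hne _ hzy] at hz
      exact hzy (by rw [h.proper _ _ _ _ hz (Sym2.eq_swap ▸ hμ), Sym2.eq_swap])
  obtain ⟨d, hdc, -, hr⟩ := h₁.exists_critical hext hxy hy hyx hyy hyc₁ hlarge (h.supp _ _ hμ).2.2
    hm₁ (h.supp _ _ hγ).2.2 hγν hγμ
  obtain ⟨t, ht, p, hp, hyp⟩ := exists_path_step_of_reachable hr.symm hxy.ne'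
  obtain rfl : t = y' := (bichromatic_adj.1 ht).1.elim (fun h' => (hyc₁ _ _ (hdc _ _ h')).1)
    fun h' => (hyc₁ _ _ (hdc _ _ h')).1
  have hut : u ≠ t := (h.adj hγ).ne
  obtain ⟨s, hsp, hs, q, hq, htq⟩ := exists_path_step p hp hyx
  have huy₁ : ∀ z, c₁ s(u, z) = c s(u, z) := fun z => hne _ fun h' => by
    rcases Sym2.eq_iff.1 h' with ⟨h', -⟩ | ⟨h', -⟩ <;> contradiction
  obtain rfl : s = u := by
    rcases (bichromatic_adj.1 hs).1 with h' | h'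
    · rw [h₁.proper _ _ _ _ (hdc _ _ h') (Sym2.eq_swap ▸ hyy)] at hsp
      contradiction
    · exact h₁.proper _ _ _ _ (hdc _ _ h') (Sym2.eq_swap ▸ (huy₁ t).trans hγ)
  obtain ⟨r, hrq, hr, -⟩ := exists_path_step q hq (h.adj hu).ne'
  rcases (bichromatic_adj.1 hr).1 with h' | h'
  · exact hmu r (huy₁ r ▸ hdc _ _ h')
  · rw [h₁.proper _ _ _ _ (hdc _ _ h') ((huy₁ t).trans hγ)] at hrq
    contradiction

end Finite

end ColorsOff

/-- Lemma 10: in the minimum-counterexample setup, if `u` is a neighbor of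
`x` of degree at least 3 with `c(x,u) = c(y,y') = μ`, then for every `γ ∈ C − F''_x(c)`,
every `(μ,γ,xy)`-critical path with respect to `c_γ` has length at least five. -/
theorem criticalPath_length_ge_five
    {V : Type*} [Fintype V] [DecidableEq V] (G : SimpleGraph V) [DecidableRel G.Adj]
    (h2deg : TwoDegenerate G)
    (hmin : ¬ ∃ c : Sym2 V → Option ℕ, IsAcyclicEdgeColoring G (G.maxDegree + 1) c)
    (hdel : ∀ e ∈ G.edgeSet, ∃ c : Sym2 V → Option ℕ,
      IsAcyclicEdgeColoring (G.deleteEdges {e}) (G.maxDegree + 1) c)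
    (x : V)
    (hxdeg2 : ∃ z, G.Adj x z ∧ G.degree z = 2)
    (hxdeg3 : ((G.neighborFinset x).filter fun z => 3 ≤ G.degree z).card ≤ 2)
    (y y' : V) (hxy : G.Adj x y) (hy2 : G.degree y = 2)
    (hyy' : G.Adj y y') (hy'x : y' ≠ x)
    (c : Sym2 V → Option ℕ)
    (hc : IsAcyclicEdgeColoring (G.deleteEdges {s(x, y)}) (G.maxDegree + 1) c)
    (μ γ : ℕ) (hμ : c s(y, y') = some μ)
    (u : V) (hu : G.Adj x u) (hu3 : 3 ≤ G.degree u) (hcu : c s(x, u) = some μ)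
    (hγC : γ < G.maxDegree + 1) (hγF : γ ∉ Fpp G c x y)
    (cγ : Sym2 V → Option ℕ)
    (hcγ : (γ ∉ Fx G c x y ∧ cγ = c) ∨
      (∃ w, G.Adj x w ∧ w ≠ y ∧ G.degree w = 2 ∧ c s(x, w) = some γ ∧
        cγ = fun e => if e = s(x, w) then none else c e)) :
    ∀ W : (G.deleteEdges {s(x, y)}).Walk x y,
      IsCriticalPath (G.deleteEdges {s(x, y)}) cγ μ γ W → 5 ≤ W.length := by
  rintro W ⟨⟨⟨hpath, hcol, -, -⟩, e₁, he₁, hce₁⟩, e₂, he₂, hce₂⟩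
  have h : ColorsOff G (G.maxDegree + 1) {s(x, y)} c := hc.colorsOff
  have hle : ∀ e a, cγ e = some a → c e = some a := by
    rcases hcγ with ⟨-, rfl⟩ | ⟨w, -, -, -, -, rfl⟩
    · exact fun _ _ => id
    · intro e a he
      by_cases hew : e = s(x, w)
      · simp [hew] at he
      · simpa [hew] using he
  match W with
  | .nil => simp at he₁
  | .cons ha .nil => simp at ha
  | .cons (v := a) ha (.cons hb .nil) =>
    obtain rfl : s(x, a) = e₁ := by simpa using he₁
    obtain rfl : s(a, y) = e₂ := by simpa using he₂
    have := h.proper a x y μ (Sym2.eq_swap ▸ hle _ _ hce₁) (hle _ _ hce₂)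
    exact (hxy.ne this).elim
  | .cons (v := a) ha (.cons (v := b) hb (.cons hd .nil)) =>
    obtain rfl : s(x, a) = e₁ := by simpa using he₁
    obtain rfl : s(b, y) = e₂ := by simpa using he₂
    obtain rfl := h.proper x a u μ (hle _ _ hce₁) hcu
    obtain rfl := h.proper y b y' μ (Sym2.eq_swap ▸ hle _ _ hce₂) hμ
    have hext : ∀ d, ¬ ColorsOff G (G.maxDegree + 1) ∅ d :=
      fun d hd => hmin ⟨d, hd.isAcyclicEdgeColoring⟩
    rcases hcol s(a, b) (by simp) with hab | hab <;>
      exact (h.ne_some_of_eq_color hext hxy hy2.le hy'x hμ hxdeg3 hcu _ (hle _ _ hab)).elim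
  | .cons (v := a) ha (.cons (v := b) hb (.cons (v := d) hd (.cons hf .nil))) =>
    obtain rfl : s(x, a) = e₁ := by simpa using he₁
    obtain rfl : s(d, y) = e₂ := by simpa using he₂
    simp only [Walk.isPath_def, Walk.support_cons, Walk.support_nil, List.nodup_cons,
      List.mem_cons, List.not_mem_nil, or_false, not_or] at hpath
    have hab := (hcol s(a, b) (by simp)).resolve_left fun h' =>
      hpath.1.2.1 (h.proper a x b μ (Sym2.eq_swap ▸ hle _ _ hce₁) (hle _ _ h'))
    have hbd := (hcol s(b, d) (by simp)).resolve_left fun h' =>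
      hpath.2.2.1.2 (h.proper d b y μ (Sym2.eq_swap ▸ hle _ _ h') (hle _ _ hce₂))
    exact (hpath.2.1.2.1 (h.proper b a d γ (Sym2.eq_swap ▸ hle _ _ hab) (hle _ _ hbd))).elim
  | .cons _ (.cons _ (.cons _ (.cons _ (.cons _ p)))) =>
    simp only [Walk.length_cons]
    omega

end AEC
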